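/- Let 𝒳 be a fuzzy random number and let A be a support median of 𝒳. Then for every α ∈ [0,1], the α-level of A satisfies A_α ⊆ [med⁻(inf 𝒳_α), med⁺(sup 𝒳_α)], where inf 𝒳_α := −s_𝒳(−1,α) and sup 𝒳_α := s_𝒳(1,α), med⁻(Y) denotes the smallest median of a real random variable Y and med⁺(Y) its largest median. (The right-hand interval is the α-level of the Grzegorzewski median of 𝒳.) -/

import Mathlib

open MeasureTheory Set ENNReal

noncomputable section

/-- The α-levels of a membership function `A : ℝ → [0,1]`. -/
def fuzzyLevel (A : ℝ → ℝ) (α : ℝ) : Set ℝ :=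
  if α = 0 then closure {x | 0 < A x} else {x | α ≤ A x}

/-- A fuzzy number: a function `ℝ → [0,1]` all of whose α-levels (α ∈ [0,1])
are nonempty compact convex subsets of ℝ. -/
structure FuzzyNumber where
  mem : ℝ → ℝ
  mem_range : ∀ x, mem x ∈ Set.Icc (0:ℝ) 1
  level_nonempty : ∀ α ∈ Set.Icc (0:ℝ) 1, (fuzzyLevel mem α).Nonempty
  level_compact : ∀ α ∈ Set.Icc (0:ℝ) 1, IsCompact (fuzzyLevel mem α)
  level_convex : ∀ α ∈ Set.Icc (0:ℝ) 1, Convex ℝ (fuzzyLevel mem α)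

/-- Support function of a fuzzy number. -/
def suppFn (A : FuzzyNumber) (u α : ℝ) : ℝ :=
  sSup ((fun v => u * v) '' fuzzyLevel A.mem α)

/-- Set of medians of a real random variable. -/
def MedSet {Ω : Type*} [MeasurableSpace Ω] (P : Measure Ω) (Y : Ω → ℝ) : Set ℝ :=
  {m : ℝ | 1/2 ≤ P {ω | Y ω ≤ m} ∧ 1/2 ≤ P {ω | m ≤ Y ω}}

/-- A fuzzy number is a support median of a fuzzy random number. -/
def IsSupportMedian {Ω : Type*} [MeasurableSpace Ω] (P : Measure Ω)
    (𝒳 : Ω → FuzzyNumber) (A : FuzzyNumber) : Prop :=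
  ∀ u ∈ ({-1, 1} : Set ℝ), ∀ α ∈ Set.Icc (0:ℝ) 1,
    suppFn A u α ∈ MedSet P (fun ω => suppFn (𝒳 ω) u α)

/-- Measurability of each real random variable `s_𝒳(u,α)`. -/
def SuppMeasurable {Ω : Type*} [MeasurableSpace Ω] (𝒳 : Ω → FuzzyNumber) : Prop :=
  ∀ u ∈ ({-1, 1} : Set ℝ), ∀ α ∈ Set.Icc (0:ℝ) 1,
    Measurable fun ω => suppFn (𝒳 ω) u α

/-- Joint measurability of `(u,α,ω) ↦ s_{𝒳(ω)}(u,α)` on {−1,1}×[0,1]×Ω. -/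
def JointlyMeasurable {Ω : Type*} [MeasurableSpace Ω] (𝒳 : Ω → FuzzyNumber) : Prop :=
  Measurable fun q : ({-1, 1} : Set ℝ) × (Set.Icc (0:ℝ) 1) × Ω =>
    suppFn (𝒳 q.2.2) (q.1 : ℝ) (q.2.1 : ℝ)

/-- The ρ₁ metric between fuzzy numbers. -/
def rho1 (A B : FuzzyNumber) : ℝ :=
  (1/2) * ∫ α in (0:ℝ)..1,
    (|suppFn A 1 α - suppFn B 1 α| + |suppFn A (-1) α - suppFn B (-1) α|)

/-- `𝒳 ∈ L¹`: the random variable `sup_{x ∈ 𝒳₀} |x|` is integrable. -/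
def FuzzyL1 {Ω : Type*} [MeasurableSpace Ω] (P : Measure Ω) (𝒳 : Ω → FuzzyNumber) : Prop :=
  Integrable (fun ω => sSup ((fun x => |x|) '' fuzzyLevel (𝒳 ω).mem 0)) P

/-- Fuzzy Tukey depth. -/
def DFT {Ω : Type*} [MeasurableSpace Ω] (P : Measure Ω) (𝒳 : Ω → FuzzyNumber)
    (A : FuzzyNumber) : ℝ≥0∞ :=
  ⨅ u ∈ ({-1, 1} : Set ℝ), ⨅ α ∈ Set.Icc (0:ℝ) 1,
    min (P {ω | suppFn (𝒳 ω) u α ≤ suppFn A u α})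
        (P {ω | suppFn A u α ≤ suppFn (𝒳 ω) u α})

/-- Midpoint median of a real random variable. -/
def medMid {Ω : Type*} [MeasurableSpace Ω] (P : Measure Ω) (Y : Ω → ℝ) : ℝ :=
  (sInf (MedSet P Y) + sSup (MedSet P Y)) / 2

/-- Median absolute deviation. -/
def MAD {Ω : Type*} [MeasurableSpace Ω] (P : Measure Ω) (Y : Ω → ℝ) : ℝ :=
  medMid P (fun ω => |Y ω - medMid P Y|)

/-- Outlyingness function. -/
def outly {Ω : Type*} [MeasurableSpace Ω] (P : Measure Ω) (𝒳 : Ω → FuzzyNumber)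
    (A : FuzzyNumber) : ℝ :=
  sSup {r : ℝ | ∃ u ∈ ({-1, 1} : Set ℝ), ∃ α ∈ Set.Icc (0:ℝ) 1,
    r = |suppFn A u α - medMid P (fun ω => suppFn (𝒳 ω) u α)| /
        MAD P (fun ω => suppFn (𝒳 ω) u α)}

/-- Fuzzy projection depth. -/
def DFP {Ω : Type*} [MeasurableSpace Ω] (P : Measure Ω) (𝒳 : Ω → FuzzyNumber)
    (A : FuzzyNumber) : ℝ :=
  (1 + outly P 𝒳 A)⁻¹

/-- Uniform probability on {−1,1} (as a measure on ℝ). -/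
def coinMeasure : Measure ℝ := (2:ℝ≥0∞)⁻¹ • (Measure.dirac (-1) + Measure.dirac 1)

/-- υ ⊗ ν on {−1,1} × [0,1]. -/
def baseMeasure : Measure (ℝ × ℝ) := coinMeasure.prod (volume.restrict (Set.Icc (0:ℝ) 1))

/-- Modified simplicial depth (p = 1, two independent copies). -/
def DmS {Ω : Type*} [MeasurableSpace Ω] (P : Measure Ω) (𝒳 : Ω → FuzzyNumber)
    (A : FuzzyNumber) : ℝ :=
  ∫ ω : Ω × Ω,
    (baseMeasure {p : ℝ × ℝ |
      min (suppFn (𝒳 ω.1) p.1 p.2) (suppFn (𝒳 ω.2) p.1 p.2) ≤ suppFn A p.1 p.2 ∧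
      suppFn A p.1 p.2 ≤ max (suppFn (𝒳 ω.1) p.1 p.2) (suppFn (𝒳 ω.2) p.1 p.2)}).toReal
    ∂(P.prod P)

/-- Fuzzy simplicial depth (p = 1). -/
def DFS {Ω : Type*} [MeasurableSpace Ω] (P : Measure Ω) (𝒳 : Ω → FuzzyNumber)
    (A : FuzzyNumber) : ℝ :=
  min
    (∫ ω : Ω × Ω,
      (volume {α ∈ Set.Icc (0:ℝ) 1 |
        min (suppFn (𝒳 ω.1) 1 α) (suppFn (𝒳 ω.2) 1 α) ≤ suppFn A 1 α ∧
        suppFn A 1 α ≤ max (suppFn (𝒳 ω.1) 1 α) (suppFn (𝒳 ω.2) 1 α)}).toReal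
      ∂(P.prod P))
    (∫ ω : Ω × Ω,
      (volume {α ∈ Set.Icc (0:ℝ) 1 |
        min (suppFn (𝒳 ω.1) (-1) α) (suppFn (𝒳 ω.2) (-1) α) ≤ suppFn A (-1) α ∧
        suppFn A (-1) α ≤ max (suppFn (𝒳 ω.1) (-1) α) (suppFn (𝒳 ω.2) (-1) α)}).toReal
      ∂(P.prod P))

/-- The medians of a random variable are bounded above. -/
theorem bddAbove_medSet {Ω : Type*} [MeasurableSpace Ω] (P : Measure Ω) [IsFiniteMeasure P]
    {Y : Ω → ℝ} (hY : Measurable Y) : BddAbove (MedSet P Y) := by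
  have hanti : Antitone fun m : ℝ => {ω | m ≤ Y ω} := fun _ _ hab _ hω => le_trans hab hω
  have hlim := tendsto_measure_iInter_atTop (μ := P)
    (fun m : ℝ => (measurableSet_le measurable_const hY).nullMeasurableSet) hanti
    ⟨0, measure_ne_top P _⟩
  have hempty : ⋂ m : ℝ, {ω | m ≤ Y ω} = ∅ := by
    refine Set.eq_empty_of_forall_notMem fun ω hω => ?_
    have := Set.mem_iInter.1 hω (Y ω + 1)
    simp only [Set.mem_ofPred_eq] at this
    linarith
  rw [hempty, measure_empty] at hlim
  obtain ⟨b, hb⟩ := (hlim.eventually_lt_const (show (0 : ℝ≥0∞) < 1 / 2 by simp)).exists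
  refine ⟨b, fun m hm => le_of_not_gt fun hbm => ?_⟩
  exact absurd (hm.2.trans (measure_mono (hanti hbm.le))) (not_le.2 hb)

/-- Negation reflects the set of medians. -/
theorem neg_mem_medSet_neg {Ω : Type*} [MeasurableSpace Ω] {P : Measure Ω} {Y : Ω → ℝ} {m : ℝ}
    (hm : m ∈ MedSet P Y) : -m ∈ MedSet P (fun ω => -Y ω) := by
  simpa [MedSet, and_comm] using hm

/-- The medians of a random variable are bounded below. -/
theorem bddBelow_medSet {Ω : Type*} [MeasurableSpace Ω] (P : Measure Ω) [IsFiniteMeasure P]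
    {Y : Ω → ℝ} (hY : Measurable Y) : BddBelow (MedSet P Y) := by
  obtain ⟨b, hb⟩ := bddAbove_medSet P hY.neg
  exact ⟨-b, fun m hm => neg_le.1 (hb (neg_mem_medSet_neg hm))⟩

/-- The support function dominates the linear functional on each level. -/
theorem mul_le_suppFn (A : FuzzyNumber) (u : ℝ) {α x : ℝ} (hα : α ∈ Set.Icc (0 : ℝ) 1)
    (hx : x ∈ fuzzyLevel A.mem α) : u * x ≤ suppFn A u α :=
  le_csSup ((A.level_compact α hα).image (continuous_const_mul u)).bddAbove
    (Set.mem_image_of_mem _ hx)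

/-- Every support median of a fuzzy random number `𝒳` has each α-level contained in
`[med⁻(inf 𝒳_α), med⁺(sup 𝒳_α)]`, the α-level of the Grzegorzewski median. -/
theorem support_median_level_subset_grzegorzewski
    {Ω : Type*} [MeasurableSpace Ω] (P : Measure Ω) [IsProbabilityMeasure P]
    (𝒳 : Ω → FuzzyNumber) (hmeas : SuppMeasurable 𝒳) (hjoint : JointlyMeasurable 𝒳)
    (A : FuzzyNumber) (hA : IsSupportMedian P 𝒳 A) :
    ∀ α ∈ Set.Icc (0:ℝ) 1,
      fuzzyLevel A.mem α ⊆
        Set.Icc (sInf (MedSet P (fun ω => -(suppFn (𝒳 ω) (-1) α))))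
                (sSup (MedSet P (fun ω => suppFn (𝒳 ω) 1 α))) := by
  intro α hα x hx
  have hlow := mul_le_suppFn A (-1) hα hx
  have hup := mul_le_suppFn A 1 hα hx
  constructor
  · refine (csInf_le (bddBelow_medSet P (hmeas (-1) (by simp) α hα).neg)
      (neg_mem_medSet_neg (hA (-1) (by simp) α hα))).trans ?_
    linarith
  · refine le_trans ?_ (le_csSup (bddAbove_medSet P (hmeas 1 (by simp) α hα))
      (hA 1 (by simp) α hα))
    linarith

end
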